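/- arXiv:1110.0139 — 3 statements merged into one kernel-verified Lean document; each statement's English description precedes it below -/
import Mathlib

section
/- Let (x_{n,m}) be a double sequence and (y_n) a sequence of reals. Suppose there is a strictly increasing sequence (k(m)) with δ({k(m) : m ∈ ℕ}) = α such that x_{n,k(m)} → y_n as m → ∞, uniformly in n. Then for every subset A of ℝ, i(x_{n,m}; A) ≥ α · i(y_n; A). -/
open Filter Set MeasureTheory
open scoped Classical Pointwise

/-- Upper density of a subset of `ℕ²`. -/
noncomputable def upperDensity2 (K : Set (ℕ × ℕ)) : ℝ :=
  limsup (fun n : ℕ =>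
    ((((Finset.Icc 1 n) ×ˢ (Finset.Icc 1 n)).filter (fun p => p ∈ K)).card : ℝ) / (n : ℝ) ^ 2)
    atTop

/-- Lower density of a subset of `ℕ²`. -/
noncomputable def lowerDensity2 (K : Set (ℕ × ℕ)) : ℝ :=
  liminf (fun n : ℕ =>
    ((((Finset.Icc 1 n) ×ˢ (Finset.Icc 1 n)).filter (fun p => p ∈ K)).card : ℝ) / (n : ℝ) ^ 2)
    atTop

/-- Upper density of a subset of `ℕ`. -/
noncomputable def upperDensity1 (K : Set ℕ) : ℝ :=
  limsup (fun n : ℕ =>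
    (((Finset.Icc 1 n).filter (fun k => k ∈ K)).card : ℝ) / (n : ℝ)) atTop

/-- Lower density of a subset of `ℕ`. -/
noncomputable def lowerDensity1 (K : Set ℕ) : ℝ :=
  liminf (fun n : ℕ =>
    (((Finset.Icc 1 n).filter (fun k => k ∈ K)).card : ℝ) / (n : ℝ)) atTop

/-- Index of convergence of a double sequence to `L ∈ ℝ`. -/
noncomputable def idx2 (x : ℕ → ℕ → ℝ) (L : ℝ) : ℝ :=
  1 - ⨆ ε > (0 : ℝ), upperDensity2 {p | x p.1 p.2 ∉ Set.Ioo (L - ε) (L + ε)}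

/-- Index of convergence of a double sequence to a set `A ⊆ ℝ`. -/
noncomputable def idxSet2 (x : ℕ → ℕ → ℝ) (A : Set ℝ) : ℝ :=
  1 - ⨆ ε > (0 : ℝ), upperDensity2 {p | x p.1 p.2 ∉ A + Set.Ioo (-ε) ε}

/-- Index of convergence of a sequence to `L ∈ ℝ`. -/
noncomputable def idx1 (x : ℕ → ℝ) (L : ℝ) : ℝ :=
  1 - ⨆ ε > (0 : ℝ), upperDensity1 {n | x n ∉ Set.Ioo (L - ε) (L + ε)}

/-- Index of convergence of a sequence to a set `A ⊆ ℝ`. -/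
noncomputable def idxSet1 (x : ℕ → ℝ) (A : Set ℝ) : ℝ :=
  1 - ⨆ ε > (0 : ℝ), upperDensity1 {n | x n ∉ A + Set.Ioo (-ε) ε}

/-- `K ⊆ ℕ` has natural density `a`. -/
def HasDensity1 (K : Set ℕ) (a : ℝ) : Prop :=
  Tendsto (fun n : ℕ =>
    (((Finset.Icc 1 n).filter (fun k => k ∈ K)).card : ℝ) / (n : ℝ)) atTop (nhds a)

/-- `K ⊆ ℕ²` has natural density `a`. -/
def HasDensity2 (K : Set (ℕ × ℕ)) (a : ℝ) : Prop :=
  Tendsto (fun n : ℕ =>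
    ((((Finset.Icc 1 n) ×ˢ (Finset.Icc 1 n)).filter (fun p => p ∈ K)).card : ℝ) / (n : ℝ) ^ 2)
    atTop (nhds a)

/-- A set `A ⊆ ℝ` is Peano–Jordan measurable. -/
def JordanMeasurable1 (A : Set ℝ) : Prop :=
  Bornology.IsBounded A ∧ volume (frontier A) = 0

/-- The Peano–Jordan measure of a Jordan measurable `A ⊆ ℝ`. -/
noncomputable def jordanMeasure1 (A : Set ℝ) : ℝ := (volume A).toReal

/-- A set `A ⊆ ℝ²` is Peano–Jordan measurable. -/
def JordanMeasurable2 (A : Set (ℝ × ℝ)) : Prop :=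
  Bornology.IsBounded A ∧ volume (frontier A) = 0

/-- The Peano–Jordan measure of a Jordan measurable `A ⊆ ℝ²`. -/
noncomputable def jordanMeasure2 (A : Set (ℝ × ℝ)) : ℝ := (volume A).toReal

lemma cnt1_bd (K : Set ℕ) (n : ℕ) :
    0 ≤ (((Finset.Icc 1 n).filter (fun k => k ∈ K)).card : ℝ) / (n : ℝ) ∧
    (((Finset.Icc 1 n).filter (fun k => k ∈ K)).card : ℝ) / (n : ℝ) ≤ 1 := by
  refine ⟨by positivity, div_le_one_of_le₀ ?_ (by positivity)⟩
  have := Finset.card_filter_le (Finset.Icc 1 n) (fun k => k ∈ K)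
  rw [Nat.card_Icc] at this
  exact_mod_cast this

lemma ud1_bdd (K : Set ℕ) : IsBoundedUnder (· ≤ ·) atTop (fun n : ℕ =>
    (((Finset.Icc 1 n).filter (fun k => k ∈ K)).card : ℝ) / (n : ℝ)) :=
  isBoundedUnder_of ⟨1, fun n => (cnt1_bd K n).2⟩

lemma ud1_cobdd (K : Set ℕ) : IsCoboundedUnder (· ≤ ·) atTop (fun n : ℕ =>
    (((Finset.Icc 1 n).filter (fun k => k ∈ K)).card : ℝ) / (n : ℝ)) :=
  IsBoundedUnder.isCoboundedUnder_le (isBoundedUnder_of ⟨0, fun n => (cnt1_bd K n).1⟩)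

lemma ud1_nonneg (K : Set ℕ) : 0 ≤ upperDensity1 K :=
  le_limsup_of_frequently_le (Frequently.of_forall fun n => (cnt1_bd K n).1) (ud1_bdd K)

lemma ud1_le_one (K : Set ℕ) : upperDensity1 K ≤ 1 :=
  limsup_le_of_le (ud1_cobdd K) (Eventually.of_forall fun n => (cnt1_bd K n).2)

lemma card_key (B : Set (ℕ × ℕ)) (C : Set ℕ) (k : ℕ → ℕ) (N : ℕ)
    (h : ∀ m ≥ N, ∀ n, n ∉ C → (n, k m) ∉ B) (n : ℕ) :
    ((((Finset.Icc 1 n) ×ˢ (Finset.Icc 1 n)).filter (fun p => p ∈ B)).card : ℝ) ≤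
      (n : ℝ) ^ 2 - ((n : ℝ) - ((Finset.Icc 1 n).filter (fun k => k ∈ C)).card) *
        ((((Finset.Icc 1 n).filter (fun j => j ∈ Set.range k)).card : ℝ) - N) := by
  set I := Finset.Icc 1 n with hI
  set P := I.filter (fun j => j ∉ C)
  set R := I.filter (fun j => j ∈ Set.range k)
  set Q := R \ (Finset.range N).image k
  have hP : ((I.filter (fun j => j ∈ C)).card : ℝ) + P.card = n := by
    have := Finset.card_filter_add_card_filter_not (s := I) (fun j => j ∈ C)
    rw [hI, Nat.card_Icc] at this
    exact_mod_cast this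
  have hQ : (R.card : ℝ) - N ≤ Q.card := by
    have h1 : R.card - ((Finset.range N).image k).card ≤ Q.card := by
      convert Finset.le_card_sdiff ((Finset.range N).image k) R
    have h2 : ((Finset.range N).image k).card ≤ N := by
      simpa using Finset.card_image_le (s := Finset.range N) (f := k)
    have : R.card ≤ Q.card + N := by omega
    have : (R.card : ℝ) ≤ Q.card + N := by exact_mod_cast this
    linarith
  have hdis : Disjoint ((I ×ˢ I).filter (fun p => p ∈ B)) (P ×ˢ Q) := by
    rw [Finset.disjoint_left]
    rintro ⟨a, b⟩ hab hpq
    simp only [Finset.mem_filter, Finset.mem_product, P, Q, R, Finset.mem_sdiff,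
      Finset.mem_image, Finset.mem_range] at hab hpq
    obtain ⟨⟨_, haC⟩, ⟨_, ⟨m, rfl⟩⟩, hm⟩ := hpq
    refine h m ?_ a haC hab.2
    by_contra hlt
    exact hm ⟨m, by omega, rfl⟩
  have hsub : ((I ×ˢ I).filter (fun p => p ∈ B)) ∪ (P ×ˢ Q) ⊆ I ×ˢ I := by
    apply Finset.union_subset (Finset.filter_subset _ _)
    exact Finset.product_subset_product (Finset.filter_subset _ _)
      (Finset.sdiff_subset.trans (Finset.filter_subset _ _))
  have hc := Finset.card_le_card hsub
  rw [Finset.card_union_of_disjoint hdis, Finset.card_product, Finset.card_product] at hc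
  have hIc : I.card = n := by rw [hI, Nat.card_Icc]; omega
  rw [hIc] at hc
  have hc' : (((I ×ˢ I).filter (fun p => p ∈ B)).card : ℝ) + P.card * Q.card ≤ n * n := by
    exact_mod_cast hc
  have hPe : (n : ℝ) - ((I.filter (fun j => j ∈ C)).card : ℝ) = P.card := by linarith
  rw [hPe]
  have := mul_le_mul_of_nonneg_left hQ (Nat.cast_nonneg (α := ℝ) P.card)
  nlinarith

lemma ud2_key (B : Set (ℕ × ℕ)) (C : Set ℕ) (k : ℕ → ℕ) (N : ℕ) (α : ℝ) (hα : 0 ≤ α)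
    (hd : HasDensity1 (Set.range k) α)
    (h : ∀ m ≥ N, ∀ n, n ∉ C → (n, k m) ∉ B) :
    upperDensity2 B ≤ 1 - α * (1 - upperDensity1 C) := by
  set s := upperDensity1 C with hs
  have main : ∀ η > 0, upperDensity2 B ≤ 1 - α * (1 - s) + (α + 1) * η := by
    intro η hη
    have e1 : ∀ᶠ n : ℕ in atTop,
        (((Finset.Icc 1 n).filter (fun k => k ∈ C)).card : ℝ) / (n : ℝ) < s + η :=
      eventually_lt_of_limsup_lt (show upperDensity1 C < s + η by linarith) (ud1_bdd C)
    have hg : Tendsto (fun n : ℕ =>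
        (((Finset.Icc 1 n).filter (fun j => j ∈ Set.range k)).card : ℝ) / (n : ℝ) - N / n)
        atTop (nhds (α - 0)) :=
      Tendsto.sub hd (tendsto_const_div_atTop_nhds_zero_nat (N : ℝ))
    rw [sub_zero] at hg
    have e2 := hg.eventually (lt_mem_nhds (show α - η < α by linarith))
    refine limsup_le_of_le (IsBoundedUnder.isCoboundedUnder_le
      (isBoundedUnder_of ⟨0, fun n => by positivity⟩)) ?_
    filter_upwards [e1, e2, eventually_gt_atTop 0] with n h1 h2 hn
    have hb := cnt1_bd C n
    have hk := card_key B C k N h n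
    have hn' : (0 : ℝ) < n := by exact_mod_cast hn
    have h3 := div_le_div_of_nonneg_right hk (sq_nonneg (n : ℝ))
    refine h3.trans ?_
    set c := (((Finset.Icc 1 n).filter (fun k => k ∈ C)).card : ℝ)
    set r := (((Finset.Icc 1 n).filter (fun j => j ∈ Set.range k)).card : ℝ)
    have e : ((n : ℝ) ^ 2 - (n - c) * (r - N)) / (n : ℝ) ^ 2
        = 1 - (1 - c / n) * (r / n - N / n) := by
      field_simp
    rw [e]
    nlinarith [mul_nonneg (sub_nonneg.2 hb.2) (sub_nonneg.2 h2.le),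
      mul_nonneg hα (sub_nonneg.2 h1.le), mul_nonneg hb.1 hη.le]
  refine le_of_forall_pos_le_add fun e he => ?_
  have := main (e / (α + 1)) (by positivity)
  rwa [mul_div_cancel₀ _ (by positivity)] at this

theorem index_double_ge_of_uniform (x : ℕ → ℕ → ℝ) (y : ℕ → ℝ) (k : ℕ → ℕ) (α : ℝ)
    (hk : StrictMono k) (hd : HasDensity1 (Set.range k) α)
    (hu : ∀ ε > (0 : ℝ), ∃ N : ℕ, ∀ m ≥ N, ∀ n : ℕ, |x n (k m) - y n| < ε)
    (A : Set ℝ) :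
    α * idxSet1 y A ≤ idxSet2 x A := by
  have hα0 : 0 ≤ α := ge_of_tendsto' hd fun n => (cnt1_bd _ n).1
  have hα1 : α ≤ 1 := le_of_tendsto' hd fun n => (cnt1_bd _ n).2
  unfold idxSet1 idxSet2
  set S := ⨆ ε > (0 : ℝ), upperDensity1 {n | y n ∉ A + Set.Ioo (-ε) ε} with hS
  have hS0 : 0 ≤ S := Real.iSup_nonneg fun ε => Real.iSup_nonneg fun _ => ud1_nonneg _
  have hle : ∀ ε > (0 : ℝ), upperDensity1 {n | y n ∉ A + Set.Ioo (-ε) ε} ≤ S := by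
    intro ε hε
    have hbdd : BddAbove (Set.range fun ε : ℝ => ⨆ (_ : ε > 0),
        upperDensity1 {n | y n ∉ A + Set.Ioo (-ε) ε}) := by
      refine ⟨1, ?_⟩
      rintro _ ⟨ε, rfl⟩
      exact Real.iSup_le (fun _ => ud1_le_one _) zero_le_one
    have h := le_ciSup hbdd ε
    simp only [ciSup_pos hε] at h
    exact h
  suffices h : (⨆ ε > (0 : ℝ), upperDensity2 {p | x p.1 p.2 ∉ A + Set.Ioo (-ε) ε})
      ≤ 1 - α * (1 - S) by linarith
  have hnn : 0 ≤ 1 - α * (1 - S) := by nlinarith [mul_nonneg hα0 hS0]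
  refine Real.iSup_le (fun ε => Real.iSup_le (fun hε => ?_) hnn) hnn
  have hε2 : 0 < ε / 2 := half_pos hε
  obtain ⟨N, hN⟩ := hu (ε / 2) hε2
  have key := ud2_key {p | x p.1 p.2 ∉ A + Set.Ioo (-ε) ε}
    {n | y n ∉ A + Set.Ioo (-(ε / 2)) (ε / 2)} k N α hα0 hd (by
      intro m hm n hn
      simp only [Set.mem_ofPred_eq, not_not] at hn ⊢
      obtain ⟨a, ha, b, hb, hab⟩ := Set.mem_add.1 hn
      have hx := abs_lt.1 (hN m hm n)
      refine Set.mem_add.2 ⟨a, ha, x n (k m) - a, ⟨?_, ?_⟩, by ring⟩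
      · linarith [hb.1, hx.1]
      · linarith [hb.2, hx.2])
  have := mul_le_mul_of_nonneg_left (hle _ hε2) hα0
  linarith
end

section
/- Let (x_n), (y_n) be real sequences and f, g : [0,1] → [0,1] injective differentiable functions with differentiable inverses. If i(x_n; A) = |f⁻¹(A)| and i(y_n; A) = |g⁻¹(A)| for every Peano–Jordan measurable A ⊆ [0,1], then for every Peano–Jordan measurable A ⊆ [0,1], the double sequence (x_n·y_m) satisfies i(x_n y_m; A) = |G⁻¹(A)| where G(x,y) = f(x)·g(y) on [0,1]². -/
open Filter Set MeasureTheory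
open scoped Classical Pointwise

open ProbabilityTheory Topology

lemma aux_count {α : Type*} [MeasurableSpace α] [MeasurableSingletonClass α] [Countable α]
    (P : Measure α) [IsProbabilityMeasure P] (S : Finset α) (c : ℝ)
    (hc : ∀ a ∈ S, P.real {a} = c) (hS : P (S : Set α)ᶜ = 0) (K : Set α) :
    P.real K = ((S.filter (fun a => a ∈ K)).card : ℝ) * c := by
  have h1 : P.real K = P.real (((S.filter (fun a => a ∈ K)) : Finset α) : Set α) := by
    have : ((((S.filter (fun a => a ∈ K)) : Finset α) : Set α)) = K ∩ (S : Set α) := by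
      ext a; simp [and_comm]
    rw [this, Measure.real, Measure.real, measure_inter_conull hS]
  rw [h1, ← sum_measureReal_singleton]
  rw [Finset.sum_congr rfl (g := fun _ => c)]
  · simp
  · intro a ha
    exact hc a (Finset.mem_filter.1 ha).1

noncomputable def tauM (n : ℕ) : Measure ℕ := uniformOn ((Finset.Icc 1 (n+1) : Finset ℕ) : Set ℕ)

instance (n : ℕ) : IsProbabilityMeasure (tauM n) :=
  isProbabilityMeasure_uniformOn (Finset.finite_toSet _) ⟨1, by simp⟩

lemma tau_sing (n : ℕ) : ∀ a ∈ Finset.Icc 1 (n+1), (tauM n).real {a} = 1 / ((n+1 : ℕ) : ℝ) := by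
  intro a ha
  have := uniformOn_apply_finset (s := Finset.Icc 1 (n+1)) (t := {a})
  rw [Finset.inter_singleton_of_mem ha] at this
  rw [Measure.real, tauM, ← Finset.coe_singleton, this, ENNReal.toReal_div]
  rw [ENNReal.toReal_natCast, ENNReal.toReal_natCast]
  simp

lemma tau_compl (n : ℕ) : (tauM n) ((Finset.Icc 1 (n+1) : Finset ℕ) : Set ℕ)ᶜ = 0 := by
  rw [tauM, uniformOn_eq_zero_iff (Finset.finite_toSet _)]
  simp

lemma ud1 (K : Set ℕ) : upperDensity1 K = limsup (fun n => (tauM n).real K) atTop := by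
  rw [upperDensity1, ← limsup_nat_add _ 1]
  congr 1
  ext n
  rw [aux_count (tauM n) _ _ (tau_sing n) (tau_compl n) K]
  rw [mul_one_div]

lemma ud2 (K : Set (ℕ × ℕ)) :
    upperDensity2 K = limsup (fun n => ((tauM n).prod (tauM n)).real K) atTop := by
  rw [upperDensity2, ← limsup_nat_add _ 1]
  congr 1
  ext n
  rw [aux_count ((tauM n).prod (tauM n)) (Finset.Icc 1 (n+1) ×ˢ Finset.Icc 1 (n+1))
    (1 / ((n+1 : ℕ) : ℝ) ^ 2) _ _ K]
  · rw [mul_one_div]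
  · rintro ⟨a, b⟩ hab
    rw [Finset.mem_product] at hab
    rw [← Set.singleton_prod_singleton, measureReal_prod_prod, tau_sing n a hab.1,
      tau_sing n b hab.2]
    ring
  · rw [Finset.coe_product, Set.compl_prod_eq_union]
    refine measure_union_null ?_ ?_
    · rw [Measure.prod_prod, tau_compl, zero_mul]
    · rw [Measure.prod_prod, tau_compl, mul_zero]

noncomputable def gidx {α : Type*} [MeasurableSpace α] (P : ℕ → Measure α) (z : α → ℝ)
    (A : Set ℝ) : ℝ :=
  1 - ⨆ ε > (0 : ℝ), limsup (fun n => (P n).real {a | z a ∉ A + Set.Ioo (-ε) ε}) atTop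

section gen
variable {α : Type*} [MeasurableSpace α] [MeasurableSingletonClass α] [Countable α]
  (P : ℕ → Measure α) [∀ n, IsProbabilityMeasure (P n)] (z : α → ℝ) (A : Set ℝ)

lemma thick (ε : ℝ) : A + Set.Ioo (-ε) ε = Metric.thickening ε A := by
  rw [← add_ball_zero, Real.ball_eq_Ioo]; simp

lemma limsup_bd (K : Set α) : 0 ≤ limsup (fun n => (P n).real K) atTop ∧
    limsup (fun n => (P n).real K) atTop ≤ 1 := by
  have hb : IsBoundedUnder (· ≤ ·) atTop (fun n => (P n).real K) :=
    isBoundedUnder_of ⟨1, fun n => measureReal_le_one⟩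
  have hb' : IsBoundedUnder (· ≥ ·) atTop (fun n => (P n).real K) :=
    isBoundedUnder_of ⟨0, fun n => measureReal_nonneg⟩
  refine ⟨?_, ?_⟩
  · exact le_limsup_of_frequently_le (Frequently.of_forall fun n => measureReal_nonneg) hb
  · exact limsup_le_of_le hb'.isCoboundedUnder_le (Eventually.of_forall fun n => measureReal_le_one)

lemma inner_sup (u : ℝ → ℝ) (h0 : ∀ ε, 0 ≤ u ε) (h1 : ∀ ε, u ε ≤ 1) :
    (∀ ε > 0, u ε ≤ ⨆ ε > (0:ℝ), u ε) ∧
    (∀ c, 0 ≤ c → (∀ ε > 0, u ε ≤ c) → (⨆ ε > (0:ℝ), u ε) ≤ c) := by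
  constructor
  · intro ε hε
    have hb : BddAbove (range fun ε : ℝ => ⨆ (_ : ε > 0), u ε) := by
      refine ⟨1, ?_⟩
      rintro _ ⟨e, rfl⟩
      exact Real.iSup_le (fun _ => h1 e) zero_le_one
    refine le_trans ?_ (le_ciSup hb ε)
    simp [hε]
  · intro c hc h
    exact Real.iSup_le (fun e => Real.iSup_le (fun he => h e he) hc) hc

lemma compl_real (n : ℕ) (ε : ℝ) : (P n).real {a | z a ∉ A + Set.Ioo (-ε) ε} =
    1 - (P n).real (z ⁻¹' (Metric.thickening ε A)) := by
  rw [thick, ← probReal_compl_eq_one_sub (Set.to_countable _).measurableSet]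
  rfl

lemma lemA {ε : ℝ} (hε : 0 < ε) {r : ℝ} (hr : r < gidx P z A) :
    ∀ᶠ n in atTop, r < (P n).real (z ⁻¹' (Metric.thickening ε A)) := by
  have h := (inner_sup (fun ε => limsup (fun n => (P n).real {a | z a ∉ A + Set.Ioo (-ε) ε}) atTop)
    (fun ε => (limsup_bd P _).1) (fun ε => (limsup_bd P _).2)).1 ε hε
  have h2 : limsup (fun n => (P n).real {a | z a ∉ A + Set.Ioo (-ε) ε}) atTop < 1 - r := by
    refine lt_of_le_of_lt h ?_
    unfold gidx at hr
    linarith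
  have := eventually_lt_of_limsup_lt h2 (isBoundedUnder_of ⟨1, fun n => measureReal_le_one⟩)
  filter_upwards [this] with n hn
  rw [compl_real] at hn
  linarith

lemma lemB {c : ℝ} (hc : c ≤ 1)
    (h1 : ∀ ε > 0, ∀ r < c, ∀ᶠ n in atTop, r < (P n).real (z ⁻¹' (Metric.thickening ε A)))
    (h2 : ∀ r > c, ∃ ε > 0, ∀ᶠ n in atTop, (P n).real (z ⁻¹' (Metric.thickening ε A)) < r) :
    gidx P z A = c := by
  obtain ⟨ha, hb⟩ := inner_sup
    (fun ε => limsup (fun n => (P n).real {a | z a ∉ A + Set.Ioo (-ε) ε}) atTop)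
    (fun ε => (limsup_bd P _).1) (fun ε => (limsup_bd P _).2)
  have e1 : (⨆ ε > (0 : ℝ), limsup (fun n => (P n).real {a | z a ∉ A + Set.Ioo (-ε) ε}) atTop)
      ≤ 1 - c := by
    refine hb _ (by linarith) fun ε hε => ?_
    refine le_of_forall_pos_le_add fun η hη => ?_
    refine limsup_le_of_le (isBoundedUnder_of ⟨0, fun n => measureReal_nonneg⟩ :
      IsBoundedUnder (· ≥ ·) atTop _).isCoboundedUnder_le ?_
    filter_upwards [h1 ε hε (c - η) (by linarith)] with n hn
    rw [compl_real]; linarith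
  have e2 : 1 - c ≤
      (⨆ ε > (0 : ℝ), limsup (fun n => (P n).real {a | z a ∉ A + Set.Ioo (-ε) ε}) atTop) := by
    refine le_of_forall_pos_le_add fun η hη => ?_
    obtain ⟨ε, hε, h⟩ := h2 (c + η) (by linarith)
    have : 1 - c - η ≤ limsup (fun n => (P n).real {a | z a ∉ A + Set.Ioo (-ε) ε}) atTop := by
      refine le_limsup_of_frequently_le (Eventually.frequently ?_)
        (isBoundedUnder_of ⟨1, fun n => measureReal_le_one⟩)
      filter_upwards [h] with n hn
      rw [compl_real]; linarith
    have := ha ε hε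
    linarith
  unfold gidx
  linarith

end gen

lemma idx1_eq (x : ℕ → ℝ) (A : Set ℝ) : idxSet1 x A = gidx tauM x A := by
  simp only [idxSet1, gidx, ud1]

lemma idx2_eq (x : ℕ → ℕ → ℝ) (A : Set ℝ) :
    idxSet2 x A = gidx (fun n => (tauM n).prod (tauM n)) (fun p => x p.1 p.2) A := by
  simp only [idxSet2, gidx, ud2]

noncomputable def lamM : Measure ℝ := volume.restrict (Set.Icc 0 1)

instance : IsProbabilityMeasure lamM := ⟨by simp [lamM]⟩

noncomputable def tauP (n : ℕ) : ProbabilityMeasure ℕ := ⟨tauM n, inferInstance⟩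
noncomputable def lamP : ProbabilityMeasure ℝ := ⟨lamM, inferInstance⟩

lemma weak_conv (x : ℕ → ℝ) (F : ℝ → ℝ) (hF : Continuous F) (hm : ∀ t, F t ∈ Set.Icc (0:ℝ) 1)
    (h : ∀ A ⊆ Set.Icc (0 : ℝ) 1, JordanMeasurable1 A →
      idxSet1 x A = (lamM (F ⁻¹' A)).toReal) :
    Tendsto (fun n => (tauP n).map (measurable_of_countable x).aemeasurable) atTop
      (𝓝 (lamP.map hF.measurable.aemeasurable)) := by
  refine tendsto_of_forall_isOpen_le_liminf' fun U hU => ?_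
  refine le_of_forall_lt fun r hr => ?_
  obtain ⟨K, hKU, hK, hrK⟩ := hU.exists_lt_isCompact hr
  obtain ⟨δ, hδ, hδU⟩ := hK.exists_thickening_subset_open hU hKU
  obtain ⟨s, ⟨hs0, hs1⟩, hs⟩ := exists_null_frontier_thickening (volume : Measure ℝ) K hδ
  set A := Metric.thickening s K ∩ Set.Icc 0 1 with hA
  have hJ : JordanMeasurable1 A := by
    refine ⟨(Metric.isBounded_Icc 0 1).subset inter_subset_right, ?_⟩
    refine measure_mono_null (frontier_inter_subset _ _) (measure_union_null ?_ ?_)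
    · exact measure_mono_null inter_subset_left hs
    · refine measure_mono_null inter_subset_right ?_
      rw [frontier_Icc zero_le_one]
      exact (Set.toFinite _).measure_zero _
  have hi := h A inter_subset_right hJ
  rw [idx1_eq] at hi
  have hr' : r < lamM (F ⁻¹' A) := by
    refine lt_of_lt_of_le hrK ?_
    rw [ProbabilityMeasure.toMeasure_map, Measure.map_apply hF.measurable hK.measurableSet]
    refine measure_mono fun t ht => ⟨Metric.self_subset_thickening hs0 _ ht, hm t⟩
  obtain ⟨q, hrq, hq⟩ := exists_between hr'
  have hqt : q ≠ ⊤ := (lt_of_lt_of_le hq le_top).ne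
  have hq' : q.toReal < gidx tauM x A := by
    rw [hi]
    exact (ENNReal.toReal_lt_toReal hqt (measure_ne_top _ _)).2 hq
  have hε : 0 < δ - s := by linarith
  have hev := lemA tauM x A hε hq'
  refine lt_of_lt_of_le hrq ?_
  refine le_liminf_of_le (by isBoundedDefault) ?_
  filter_upwards [hev] with n hn
  rw [ProbabilityMeasure.toMeasure_map,
    Measure.map_apply (measurable_of_countable x) hU.measurableSet]
  have : q < tauM n (x ⁻¹' Metric.thickening (δ - s) A) := by
    rw [← ENNReal.toReal_lt_toReal hqt (measure_ne_top _ _)]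
    exact hn
  refine this.le.trans (measure_mono (preimage_mono ?_))
  refine Subset.trans ?_ hδU
  refine (Metric.thickening_subset_of_subset _ inter_subset_left).trans ?_
  refine (Metric.thickening_thickening_subset _ _ _).trans ?_
  simp

lemma null_pre (f F finv : ℝ → ℝ) (hFf : ∀ t ∈ Set.Icc (0:ℝ) 1, F t = f t)
    (hm : ∀ t, F t ∈ Set.Icc (0:ℝ) 1)
    (hleft : ∀ t ∈ Set.Icc (0 : ℝ) 1, finv (f t) = t)
    (hd : DifferentiableOn ℝ finv (Set.Icc 0 1)) (B : Set ℝ) (hB : volume B = 0) :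
    lamM (F ⁻¹' B) = 0 := by
  rw [lamM, Measure.restrict_apply' measurableSet_Icc]
  refine measure_mono_null (t := finv '' (B ∩ Set.Icc 0 1)) ?_ ?_
  · rintro t ⟨ht, ht1⟩
    exact ⟨F t, ⟨ht, hm t⟩, by rw [hFf t ht1, hleft t ht1]⟩
  · exact addHaar_image_eq_zero_of_differentiableOn_of_addHaar_eq_zero _
      (hd.mono inter_subset_right) (measure_mono_null inter_subset_left hB)

lemma null_prod (F G : ℝ → ℝ) (hF : Continuous F) (hG : Continuous G)
    (nF : ∀ B, volume B = 0 → lamM (F ⁻¹' B) = 0) (nG : ∀ B, volume B = 0 → lamM (G ⁻¹' B) = 0)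
    (B : Set ℝ) (hBm : MeasurableSet B) (hB : volume B = 0) :
    (lamM.prod lamM) {p | F p.1 * G p.2 ∈ B} = 0 := by
  have hm : MeasurableSet {p : ℝ × ℝ | F p.1 * G p.2 ∈ B} := by
    have : Continuous fun p : ℝ × ℝ => F p.1 * G p.2 := by fun_prop
    exact this.measurable hBm
  rw [Measure.measure_prod_null hm]
  have h0 : ∀ᵐ a ∂lamM, F a ≠ 0 := by
    have := nF {0} (by simp)
    rw [ae_iff]
    simpa [preimage] using this
  filter_upwards [h0] with a ha
  have : Prod.mk a ⁻¹' {p : ℝ × ℝ | F p.1 * G p.2 ∈ B} = G ⁻¹' ((fun t => F a * t) ⁻¹' B) := rfl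
  rw [this]
  refine nG _ ?_
  rw [Real.volume_preimage_mul_left ha, hB, mul_zero]

lemma main_aux (x y : ℕ → ℝ) (F G : ℝ → ℝ) (hF : Continuous F) (hG : Continuous G)
    (nF : ∀ B, volume B = 0 → lamM (F ⁻¹' B) = 0) (nG : ∀ B, volume B = 0 → lamM (G ⁻¹' B) = 0)
    (wF : Tendsto (fun n => (tauP n).map (measurable_of_countable x).aemeasurable) atTop
      (𝓝 (lamP.map hF.measurable.aemeasurable)))
    (wG : Tendsto (fun n => (tauP n).map (measurable_of_countable y).aemeasurable) atTop
      (𝓝 (lamP.map hG.measurable.aemeasurable)))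
    (A : Set ℝ) (hA : JordanMeasurable1 A) :
    idxSet2 (fun n m => x n * y m) A = ((lamM.prod lamM) {p | F p.1 * G p.2 ∈ A}).toReal := by
  have hmul : Continuous (fun p : ℝ × ℝ => p.1 * p.2) := continuous_mul
  have hH : Continuous fun p : ℝ × ℝ => F p.1 * G p.2 := by fun_prop
  have w := (ProbabilityMeasure.continuous_prod (α := ℝ) (β := ℝ)).continuousAt.tendsto.comp
    (wF.prodMk_nhds wG)
  have w2 := ProbabilityMeasure.tendsto_map_of_tendsto_of_continuous _ _ w hmul
  set ρ := ((lamP.map hF.measurable.aemeasurable).prod (lamP.map hG.measurable.aemeasurable)).map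
    hmul.measurable.aemeasurable with hρ
  have eρ : ∀ B, MeasurableSet B →
      (ρ : Measure ℝ) B = (lamM.prod lamM) {p | F p.1 * G p.2 ∈ B} := by
    intro B hB
    rw [hρ, ProbabilityMeasure.toMeasure_map, ProbabilityMeasure.toMeasure_prod,
      ProbabilityMeasure.toMeasure_map, ProbabilityMeasure.toMeasure_map,
      Measure.map_prod_map _ _ hF.measurable hG.measurable,
      Measure.map_apply hmul.measurable hB,
      Measure.map_apply (by fun_prop) (hmul.measurable hB)]
    rfl
  have en : ∀ n, ∀ B, MeasurableSet B →
      ((((tauP n).map (measurable_of_countable x).aemeasurable).prod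
        ((tauP n).map (measurable_of_countable y).aemeasurable)).map
          hmul.measurable.aemeasurable : Measure ℝ) B =
      ((tauM n).prod (tauM n)) ((fun p : ℕ × ℕ => x p.1 * y p.2) ⁻¹' B) := by
    intro n B hB
    rw [ProbabilityMeasure.toMeasure_map, ProbabilityMeasure.toMeasure_prod,
      ProbabilityMeasure.toMeasure_map, ProbabilityMeasure.toMeasure_map,
      Measure.map_prod_map _ _ (measurable_of_countable x) (measurable_of_countable y),
      Measure.map_apply hmul.measurable hB,
      Measure.map_apply (measurable_of_countable _) (hmul.measurable hB)]
    rfl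
  have nρ : (ρ : Measure ℝ) (frontier A) = 0 := by
    rw [eρ _ isClosed_frontier.measurableSet]
    exact null_prod F G hF hG nF nG _ isClosed_frontier.measurableSet hA.2
  have hcl : (ρ : Measure ℝ) (closure A) = (lamM.prod lamM) {p | F p.1 * G p.2 ∈ A} := by
    apply le_antisymm
    · rw [closure_eq_interior_union_frontier]
      refine (measure_union_le _ _).trans ?_
      rw [nρ, add_zero, eρ _ isOpen_interior.measurableSet]
      exact measure_mono fun p hp => (interior_subset (s := A)) hp
    · rw [eρ _ isClosed_closure.measurableSet]
      exact measure_mono fun p hp => subset_closure hp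
  rw [idx2_eq, ← hcl]
  apply lemB
  · exact measureReal_le_one
  · intro ε hε r hr
    rcases lt_or_ge r 0 with hr0 | hr0
    · exact Eventually.of_forall fun n => hr0.trans_le measureReal_nonneg
    have hop : IsOpen (Metric.thickening ε A) := Metric.isOpen_thickening
    have h1 : ENNReal.ofReal r < (ρ : Measure ℝ) (Metric.thickening ε A) := by
      refine lt_of_lt_of_le ((ENNReal.ofReal_lt_iff_lt_toReal hr0 (measure_ne_top _ _)).2 hr) ?_
      exact measure_mono (Metric.closure_subset_thickening hε _)
    have h2 := eventually_lt_of_lt_liminf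
      (h1.trans_le (ProbabilityMeasure.le_liminf_measure_open_of_tendsto w2 hop))
    filter_upwards [h2] with n hn
    have hn' := hn.trans_eq (en n _ hop.measurableSet)
    exact (ENNReal.ofReal_lt_iff_lt_toReal hr0 (measure_ne_top _ _)).1 hn'
  · intro r hr
    have hr' : (ρ : Measure ℝ) (closure A) < ENNReal.ofReal r :=
      (ENNReal.lt_ofReal_iff_toReal_lt (measure_ne_top _ _)).2 hr
    have ht := tendsto_measure_cthickening (μ := (ρ : Measure ℝ)) (s := A)
      ⟨1, zero_lt_one, measure_ne_top _ _⟩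
    have ht2 := ((ht.eventually (gt_mem_nhds hr')).filter_mono
      (nhdsWithin_le_nhds (s := Set.Ioi 0))).and self_mem_nhdsWithin
    obtain ⟨ε, hε, hε0⟩ := ht2.exists
    refine ⟨ε, hε0, ?_⟩
    have hcl : IsClosed (Metric.cthickening ε A) := Metric.isClosed_cthickening
    have h2 := eventually_lt_of_limsup_lt
      ((ProbabilityMeasure.limsup_measure_closed_le_of_tendsto w2 hcl).trans_lt hε)
    filter_upwards [h2] with n hn
    have hn' := (en n _ hcl.measurableSet).symm.trans_lt hn
    refine (ENNReal.lt_ofReal_iff_toReal_lt (measure_ne_top _ _)).1 (lt_of_le_of_lt ?_ hn')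
    exact measure_mono (preimage_mono (Metric.thickening_subset_cthickening _ _))

lemma ext_exists (f : ℝ → ℝ) (hfmaps : Set.MapsTo f (Set.Icc 0 1) (Set.Icc 0 1))
    (hc : ContinuousOn f (Set.Icc 0 1)) :
    ∃ F : ℝ → ℝ, Continuous F ∧ (∀ t, F t ∈ Set.Icc (0:ℝ) 1) ∧
      ∀ t ∈ Set.Icc (0:ℝ) 1, F t = f t := by
  refine ⟨Set.IccExtend zero_le_one ((Set.Icc (0:ℝ) 1).restrict f), ?_, ?_, ?_⟩
  · exact (continuousOn_iff_continuous_restrict.1 hc).Icc_extend'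
  · intro t
    exact hfmaps (Set.projIcc 0 1 zero_le_one t).2
  · intro t ht
    rw [Set.IccExtend_of_mem _ _ ht]; rfl

lemma pre_eq (f F : ℝ → ℝ) (hFf : ∀ t ∈ Set.Icc (0:ℝ) 1, F t = f t) (A : Set ℝ) :
    jordanMeasure1 (Set.Icc 0 1 ∩ f ⁻¹' A) = (lamM (F ⁻¹' A)).toReal := by
  rw [jordanMeasure1, lamM, Measure.restrict_apply' measurableSet_Icc]
  congr 2
  ext t
  constructor
  · rintro ⟨h, h'⟩
    exact ⟨by rw [mem_preimage, hFf t h]; exact h', h⟩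
  · rintro ⟨h', h⟩
    exact ⟨h, by rw [mem_preimage, ← hFf t h]; exact h'⟩

theorem index_product_sequences (x y : ℕ → ℝ) (f g : ℝ → ℝ) (finv ginv : ℝ → ℝ)
    (hfmaps : Set.MapsTo f (Set.Icc 0 1) (Set.Icc 0 1))
    (hgmaps : Set.MapsTo g (Set.Icc 0 1) (Set.Icc 0 1))
    (hfinj : Set.InjOn f (Set.Icc 0 1)) (hginj : Set.InjOn g (Set.Icc 0 1))
    (hfleft : ∀ t ∈ Set.Icc (0 : ℝ) 1, finv (f t) = t)
    (hfright : ∀ t ∈ Set.Icc (0 : ℝ) 1, f (finv t) = t)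
    (hgleft : ∀ t ∈ Set.Icc (0 : ℝ) 1, ginv (g t) = t)
    (hgright : ∀ t ∈ Set.Icc (0 : ℝ) 1, g (ginv t) = t)
    (hdf : DifferentiableOn ℝ f (Set.Icc 0 1))
    (hdfinv : DifferentiableOn ℝ finv (Set.Icc 0 1))
    (hdg : DifferentiableOn ℝ g (Set.Icc 0 1))
    (hdginv : DifferentiableOn ℝ ginv (Set.Icc 0 1))
    (hidxf : ∀ A ⊆ Set.Icc (0 : ℝ) 1, JordanMeasurable1 A →
      idxSet1 x A = jordanMeasure1 (Set.Icc 0 1 ∩ f ⁻¹' A))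
    (hidxg : ∀ A ⊆ Set.Icc (0 : ℝ) 1, JordanMeasurable1 A →
      idxSet1 y A = jordanMeasure1 (Set.Icc 0 1 ∩ g ⁻¹' A)) :
    ∀ A ⊆ Set.Icc (0 : ℝ) 1, JordanMeasurable1 A →
      idxSet2 (fun n m => x n * y m) A =
        jordanMeasure2 ((Set.Icc 0 1 ×ˢ Set.Icc 0 1) ∩
          {p : ℝ × ℝ | f p.1 * g p.2 ∈ A}) := by
  intro A _ hA
  obtain ⟨F, hF, mF, eF⟩ := ext_exists f hfmaps hdf.continuousOn
  obtain ⟨G, hG, mG, eG⟩ := ext_exists g hgmaps hdg.continuousOn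
  have wF := weak_conv x F hF mF fun A h1 h2 => (hidxf A h1 h2).trans (pre_eq f F eF A)
  have wG := weak_conv y G hG mG fun A h1 h2 => (hidxg A h1 h2).trans (pre_eq g G eG A)
  rw [main_aux x y F G hF hG (null_pre f F finv eF mF hfleft hdfinv)
    (null_pre g G ginv eG mG hgleft hdginv) wF wG A hA]
  rw [jordanMeasure2, lamM, Measure.prod_restrict,
    Measure.restrict_apply' (measurableSet_Icc.prod measurableSet_Icc), ← Measure.volume_eq_prod]
  congr 2
  ext ⟨s, t⟩
  constructor
  · rintro ⟨h', h⟩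
    refine ⟨h, ?_⟩
    simp only [mem_setOf_eq] at h' ⊢
    rw [← eF s h.1, ← eG t h.2]; exact h'
  · rintro ⟨h, h'⟩
    refine ⟨?_, h⟩
    simp only [mem_setOf_eq] at h' ⊢
    rw [eF s h.1, eG t h.2]; exact h'
end

section
/- Let α, γ ∈ [0,1) be irrational and β, δ ∈ [0,1). Define x_{n,m} = {nα + β}·{mγ + δ}, where {t} denotes the fractional part. Then for every Peano–Jordan measurable set A ⊆ [0,1), the double sequence (x_{n,m}) satisfies i(x_{n,m}; A) = |G⁻¹(A)| where G(x,y) = x·y on [0,1]². -/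
open Filter Set MeasureTheory
open scoped Classical Pointwise

open Topology

noncomputable def unifN (N : ℕ) : Measure ℕ :=
  ((N + 1 : ℕ) : ENNReal)⁻¹ • ∑ k ∈ Finset.Icc 1 (N + 1), Measure.dirac k

lemma unifN_apply (N : ℕ) (K : Set ℕ) : unifN N K =
    ((N + 1 : ℕ) : ENNReal)⁻¹ * (((Finset.Icc 1 (N+1)).filter (fun k => k ∈ K)).card : ENNReal) := by
  simp [unifN, Measure.finsetSum_apply, Set.indicator_apply]

instance (N : ℕ) : IsProbabilityMeasure (unifN N) := by
  constructor
  rw [unifN_apply]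
  simp only [mem_univ, Finset.filter_true, Nat.card_Icc, Nat.add_sub_cancel]
  exact ENNReal.inv_mul_cancel (by simp) (ENNReal.natCast_ne_top _)

lemma unifN_prod_apply (N : ℕ) (K : Set (ℕ × ℕ)) : ((unifN N).prod (unifN N)).real K =
    ((((Finset.Icc 1 (N+1)) ×ˢ (Finset.Icc 1 (N+1))).filter (fun p => p ∈ K)).card : ℝ)
      / ((N + 1 : ℕ) : ℝ) ^ 2 := by
  have h : ((unifN N).prod (unifN N)) K = ((N + 1 : ℕ) : ENNReal)⁻¹ * (((N + 1 : ℕ) : ENNReal)⁻¹ *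
     ((((Finset.Icc 1 (N+1)) ×ˢ (Finset.Icc 1 (N+1))).filter (fun p => p ∈ K)).card : ENNReal)) := by
    rw [Measure.prod_apply (MeasurableSet.of_discrete)]
    simp_rw [unifN_apply]
    rw [unifN, lintegral_smul_measure, lintegral_finsetSum_measure]
    simp_rw [lintegral_dirac]
    rw [← Finset.mul_sum, smul_eq_mul]
    congr 2
    rw [← Nat.cast_sum]
    congr 1
    simp only [Finset.card_filter, Finset.sum_product, mem_preimage]
  rw [measureReal_def, h]
  simp only [ENNReal.toReal_mul, ENNReal.toReal_inv, ENNReal.toReal_natCast]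
  have : ((N + 1 : ℕ) : ℝ) ≠ 0 := by positivity
  field_simp

lemma integral_unifN (N : ℕ) (f : ℕ → ℂ) : ∫ n, f n ∂(unifN N) =
    ((N + 1 : ℕ) : ℂ)⁻¹ * ∑ k ∈ Finset.Icc 1 (N + 1), f k := by
  rw [unifN, integral_smul_measure, integral_finsetSum_measure]
  · rw [ENNReal.toReal_inv, ENNReal.toReal_natCast]
    simp [integral_dirac]
  · intro i _
    exact integrable_dirac (by simp)

noncomputable def unifP (N : ℕ) : ProbabilityMeasure ℕ := ⟨unifN N, inferInstance⟩

lemma exp_avg (z c : ℂ) (hz : ‖z‖ = 1) (hz1 : z ≠ 1) :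
    Tendsto (fun N : ℕ => ((N + 1 : ℕ) : ℂ)⁻¹ * ∑ k ∈ Finset.Icc 1 (N + 1), c * z ^ k) atTop (𝓝 0) := by
  have hz1' : 0 < ‖z - 1‖ := norm_pos_iff.mpr (sub_ne_zero.mpr hz1)
  have hb : ∀ N : ℕ, ‖((N + 1 : ℕ) : ℂ)⁻¹ * ∑ k ∈ Finset.Icc 1 (N + 1), c * z ^ k‖ ≤
      (‖c‖ * 2 / ‖z - 1‖) * (1 / ((N : ℝ) + 1)) := by
    intro N
    have : ∑ k ∈ Finset.Icc 1 (N + 1), c * z ^ k = c * (z * ((z ^ (N+1) - 1) / (z - 1))) := by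
      rw [← geom_sum_eq hz1, Finset.mul_sum, Finset.mul_sum, ← Finset.Ico_add_one_right_eq_Icc,
        Finset.sum_Ico_eq_sum_range]
      apply Finset.sum_congr (by simp)
      intro i _
      ring
    rw [this]
    have h2 : ‖z ^ (N+1) - 1‖ ≤ 2 := by
      refine (norm_sub_le _ _).trans ?_
      simp [hz]; norm_num
    simp only [norm_mul, norm_div, norm_inv, hz, one_mul, Complex.norm_natCast]
    push_cast
    rw [mul_comm, ← one_div]
    gcongr
    rw [mul_div_assoc]
    gcongr
  apply squeeze_zero_norm hb
  simpa using tendsto_one_div_add_atTop_nhds_zero_nat.const_mul (‖c‖ * 2 / ‖z - 1‖)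

noncomputable def haarP : ProbabilityMeasure (AddCircle (1:ℝ)) :=
  ⟨AddCircle.haarAddCircle, inferInstance⟩

lemma weyl_circle (α β : ℝ) (hα : Irrational α) :
    Tendsto (fun N => (unifP N).map (f := fun n : ℕ => ((n * α + β : ℝ) : AddCircle (1:ℝ)))
      (Measurable.of_discrete).aemeasurable) atTop (𝓝 haarP) := by
  refine ProbabilityMeasure.tendsto_of_tight_of_separatesPoints ℂ
    (A := (fourierSubalgebra (T := 1)).comap (BoundedContinuousFunction.toContinuousMapStarₐ ℂ))
    IsTightMeasureSet.of_compactSpace ?_ ?_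
  · intro x y hxy
    obtain ⟨f, ⟨g, hg, rfl⟩, hne⟩ := fourierSubalgebra_separatesPoints (T := 1) hxy
    refine ⟨_, ⟨g, ⟨BoundedContinuousFunction.mkOfCompact g, hg, rfl⟩, rfl⟩, hne⟩
  · intro g hg
    have hg' : (g : C(AddCircle (1:ℝ), ℂ)) ∈ Submodule.span ℂ (range (@fourier (1:ℝ))) := by
      rw [← fourierSubalgebra_coe]; exact hg
    suffices H : ∀ f ∈ Submodule.span ℂ (range (@fourier (1:ℝ))),
        Tendsto (fun N => ∫ n, f ((n * α + β : ℝ) : AddCircle (1:ℝ)) ∂(unifN N)) atTop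
          (𝓝 (∫ x, f x ∂AddCircle.haarAddCircle)) by
      refine (H _ hg').congr ?_
      intro N
      rw [ProbabilityMeasure.toMeasure_map, integral_map]
      · rfl
      · exact (Measurable.of_discrete).aemeasurable
      · exact g.continuous.aestronglyMeasurable
    intro f hf
    have hint : ∀ (f : C(AddCircle (1:ℝ), ℂ)), Integrable f AddCircle.haarAddCircle :=
      fun f => f.continuous.integrable_of_hasCompactSupport (HasCompactSupport.of_compactSpace _)
    simp_rw [integral_unifN]
    induction hf using Submodule.span_induction with
    | mem f hf =>
      obtain ⟨k, rfl⟩ := hf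
      by_cases hk : k = 0
      · subst hk
        simp only [fourier_zero]
        simp
        apply tendsto_const_nhds.congr
        intro N
        have : ((N:ℂ) + 1) ≠ 0 := by exact_mod_cast Nat.succ_ne_zero N
        field_simp
      · have h0 : ∫ x, fourier k x ∂(AddCircle.haarAddCircle (T := 1)) = 0 :=
          integral_eq_zero_of_add_right_eq_neg (μ := AddCircle.haarAddCircle)
            (fourier_add_half_inv_index hk Fact.out)
        rw [h0]
        have hz : fourier k ((α : ℝ) : AddCircle (1:ℝ)) ≠ 1 := by
          rw [fourier_coe_apply]
          intro h
          rw [Complex.exp_eq_one_iff] at h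
          obtain ⟨m, hm⟩ := h
          have h2 : (2 * (Real.pi:ℂ) * Complex.I) ≠ 0 := by
            simp [Real.pi_ne_zero]
          have h3 : ((k:ℂ) * α) = m := by
            apply mul_left_cancel₀ h2
            rw [mul_comm _ (m:ℂ), ← hm]; push_cast; ring
          have h4 : (k:ℝ) * α = m := by exact_mod_cast h3
          exact (hα.intCast_mul hk).ne_int m h4
        refine (exp_avg _ (fourier k ((β : ℝ) : AddCircle (1:ℝ))) ?_ hz).congr ?_
        · rw [fourier_apply]; exact Circle.norm_coe _
        · intro N
          congr 1
          apply Finset.sum_congr rfl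
          intro n _
          rw [fourier_coe_apply, fourier_coe_apply, fourier_coe_apply, ← Complex.exp_nat_mul,
            ← Complex.exp_add]
          congr 1
          push_cast
          ring
    | zero => simp
    | add f g _ _ hf hg =>
      simp only [ContinuousMap.add_apply, Finset.sum_add_distrib, mul_add]
      rw [integral_add (hint f) (hint g)]
      exact hf.add hg
    | smul c f _ hf =>
      simp only [ContinuousMap.smul_apply, smul_eq_mul, ← Finset.mul_sum]
      rw [integral_const_mul]
      refine (hf.const_mul c).congr ?_
      intro N; ring

instance : IsProbabilityMeasure (volume.restrict (Icc (0:ℝ) 1)) := ⟨by simp⟩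

noncomputable def lebP : ProbabilityMeasure ℝ := ⟨volume.restrict (Icc (0:ℝ) 1), inferInstance⟩

lemma weyl_fract (α β : ℝ) (hα : Irrational α) :
    Tendsto (fun N => (unifP N).map (f := fun n : ℕ => Int.fract (n * α + β : ℝ))
      (Measurable.of_discrete).aemeasurable) atTop (𝓝 lebP) := by
  apply tendsto_of_forall_isOpen_le_liminf_nat'
  intro G hG
  set V : Set (AddCircle (1:ℝ)) := (fun x : ℝ => (x : AddCircle (1:ℝ))) '' (G ∩ Ioo 0 1) with hV
  have hVo : IsOpen V := QuotientAddGroup.isOpenMap_coe _ (hG.inter isOpen_Ioo)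
  have h1 := ProbabilityMeasure.le_liminf_measure_open_of_tendsto (weyl_circle α β hα) hVo
  have h2 : (lebP : Measure ℝ) G ≤ (haarP : Measure (AddCircle (1:ℝ))) V := by
    have e : (haarP : Measure (AddCircle (1:ℝ))) = volume := by
      rw [AddCircle.volume_eq_smul_haarAddCircle]
      simp [haarP]
    rw [e, AddCircle.add_projection_respects_measure 1 0 hVo.measurableSet]
    change (volume.restrict (Icc (0:ℝ) 1)) G ≤ _
    rw [← restrict_Ioo_eq_restrict_Icc, Measure.restrict_apply hG.measurableSet]
    apply measure_mono
    intro x hx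
    exact ⟨⟨x, hx, rfl⟩, hx.2.1, by simpa using hx.2.2.le⟩
  refine h2.trans (h1.trans ?_)
  refine liminf_le_liminf ?_
  · refine Eventually.of_forall fun N => ?_
    rw [ProbabilityMeasure.toMeasure_map, ProbabilityMeasure.toMeasure_map,
      Measure.map_apply Measurable.of_discrete hVo.measurableSet,
      Measure.map_apply Measurable.of_discrete hG.measurableSet]
    apply measure_mono
    rintro n ⟨s, ⟨hs, hs1⟩, hsn⟩
    have : Int.fract (n * α + β) = s := by
      have hsn' : (s : AddCircle (1:ℝ)) = ((n * α + β : ℝ) : AddCircle (1:ℝ)) := hsn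
      have hz : (((n * α + β) - s : ℝ) : AddCircle (1:ℝ)) = 0 := by
        rw [AddCircle.coe_sub, hsn', sub_self]
      obtain ⟨k, hk⟩ := (AddCircle.coe_eq_zero_iff 1).1 hz
      rw [Int.fract_eq_iff]
      exact ⟨hs1.1.le, hs1.2, k, by rw [← hk]; simp⟩
    simpa [this] using hs

lemma weyl_prod (α γ β δ : ℝ) (hα : Irrational α) (hγ : Irrational γ) :
    Tendsto (fun N => ((unifP N).prod (unifP N)).map
      (f := fun p : ℕ × ℕ => Int.fract (p.1 * α + β : ℝ) * Int.fract (p.2 * γ + δ))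
      (Measurable.of_discrete).aemeasurable) atTop
      (𝓝 ((lebP.prod lebP).map (f := fun p : ℝ × ℝ => p.1 * p.2)
        (continuous_mul.measurable.aemeasurable))) := by
  have h := ((ProbabilityMeasure.continuous_prod (α := ℝ) (β := ℝ)).tendsto (lebP, lebP)).comp
    ((weyl_fract α β hα).prodMk_nhds (weyl_fract γ δ hγ))
  have h' := ProbabilityMeasure.tendsto_map_of_tendsto_of_continuous _ _ h
    (continuous_mul (M := ℝ))
  refine h'.congr ?_
  intro N
  simp only [Function.comp]
  apply Subtype.ext
  simp only [ProbabilityMeasure.val_eq_to_measure, ProbabilityMeasure.toMeasure_map,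
    ProbabilityMeasure.toMeasure_prod]
  rw [Measure.map_prod_map _ _ Measurable.of_discrete Measurable.of_discrete]
  rw [Measure.map_map continuous_mul.measurable Measurable.of_discrete]
  rfl

lemma null_mul (F : Set ℝ) (hF : IsClosed F) (h0 : volume F = 0) :
    ((lebP.prod lebP : ProbabilityMeasure (ℝ × ℝ)) : Measure (ℝ × ℝ)) {p | p.1 * p.2 ∈ F} = 0 := by
  have hm : MeasurableSet {p : ℝ × ℝ | p.1 * p.2 ∈ F} :=
    continuous_mul.measurable hF.measurableSet
  rw [ProbabilityMeasure.toMeasure_prod, Measure.measure_prod_null hm]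
  have hle : (lebP : Measure ℝ) ≤ volume := Measure.restrict_le_self
  have : ∀ᵐ x : ℝ ∂(lebP : Measure ℝ), x ≠ 0 :=
    (Measure.absolutelyContinuous_of_le hle).ae_le (Measure.ae_ne volume 0)
  filter_upwards [this] with x hx
  refine le_antisymm ((hle _).trans ?_) zero_le
  have : Prod.mk x ⁻¹' {p : ℝ × ℝ | p.1 * p.2 ∈ F} = (fun y => x * y) ⁻¹' F := rfl
  rw [this, Real.volume_preimage_mul_left hx, h0]
  simp

theorem index_fract_product (α γ β δ : ℝ)
    (hα : α ∈ Set.Ico (0 : ℝ) 1) (hγ : γ ∈ Set.Ico (0 : ℝ) 1)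
    (hβ : β ∈ Set.Ico (0 : ℝ) 1) (hδ : δ ∈ Set.Ico (0 : ℝ) 1)
    (hiα : Irrational α) (hiγ : Irrational γ) :
    ∀ A ⊆ Set.Ico (0 : ℝ) 1, JordanMeasurable1 A →
      idxSet2 (fun n m => Int.fract (n * α + β) * Int.fract (m * γ + δ)) A =
        jordanMeasure2 ((Set.Icc 0 1 ×ˢ Set.Icc 0 1) ∩
          {p : ℝ × ℝ | p.1 * p.2 ∈ A}) := by
  intro A hA hJ
  have hw := weyl_prod α γ β δ hiα hiγ
  set X : ℕ × ℕ → ℝ := fun p => Int.fract (p.1 * α + β : ℝ) * Int.fract (p.2 * γ + δ) with hX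
  set ν : ProbabilityMeasure ℝ := (lebP.prod lebP).map (f := fun p : ℝ × ℝ => p.1 * p.2)
        (continuous_mul.measurable.aemeasurable) with hν
  -- the right-hand side
  have hR : jordanMeasure2 ((Set.Icc 0 1 ×ˢ Set.Icc 0 1) ∩ {p : ℝ × ℝ | p.1 * p.2 ∈ A}) =
      (ν : Measure ℝ).real (closure A) := by
    have e : ((lebP.prod lebP : ProbabilityMeasure (ℝ × ℝ)) : Measure (ℝ × ℝ)) =
        volume.restrict (Icc (0:ℝ) 1 ×ˢ Icc (0:ℝ) 1) := by
      rw [ProbabilityMeasure.toMeasure_prod]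
      exact Measure.prod_restrict _ _
    rw [jordanMeasure2, measureReal_def]
    congr 1
    rw [inter_comm, ← Measure.restrict_apply' (measurableSet_Icc.prod measurableSet_Icc), ← e,
      ProbabilityMeasure.toMeasure_map,
      Measure.map_apply continuous_mul.measurable isClosed_closure.measurableSet]
    apply le_antisymm
    · exact measure_mono fun p hp => subset_closure hp
    · have hn := null_mul (frontier A) isClosed_frontier hJ.2
      refine (measure_mono (t := {p : ℝ × ℝ | p.1 * p.2 ∈ A} ∪
        {p | p.1 * p.2 ∈ frontier A}) ?_).trans ((measure_union_le _ _).trans (by rw [hn, add_zero]))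
      intro p hp
      by_cases h : p.1 * p.2 ∈ A
      · exact Or.inl h
      · exact Or.inr ⟨hp, fun hi => h (interior_subset hi)⟩
  rw [hR]
  -- densities
  have hden : ∀ K : Set ℝ, MeasurableSet K → upperDensity2 {p | X p ∈ K} =
      limsup (fun N => ((((unifP N).prod (unifP N)).map
        (Measurable.of_discrete (f := X)).aemeasurable : ProbabilityMeasure ℝ) :
          Measure ℝ).real K) atTop := by
    intro K hK
    rw [upperDensity2, ← limsup_nat_add _ 1]
    congr 1
    funext N
    rw [ProbabilityMeasure.toMeasure_map, measureReal_def,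
      Measure.map_apply Measurable.of_discrete hK, ← measureReal_def]
    exact (unifN_prod_apply N _).symm
  set μ : ℕ → ProbabilityMeasure ℝ := fun N => ((unifP N).prod (unifP N)).map
        (Measurable.of_discrete (f := X)).aemeasurable with hμ
  have hb1 : ∀ K : Set ℝ, IsBoundedUnder (· ≤ ·) atTop (fun N => (μ N : Measure ℝ).real K) :=
    fun K => ⟨1, by simp⟩
  have hb0 : ∀ K : Set ℝ, IsCoboundedUnder (· ≤ ·) atTop (fun N => (μ N : Measure ℝ).real K) :=
    fun K => IsBoundedUnder.isCoboundedUnder_le ⟨0, by simp⟩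
  have hclosed : ∀ K : Set ℝ, IsClosed K →
      limsup (fun N => (μ N : Measure ℝ).real K) atTop ≤ (ν : Measure ℝ).real K := by
    intro K hK
    have h := ProbabilityMeasure.limsup_measure_closed_le_of_tendsto hw hK
    apply le_of_forall_gt_imp_ge_of_dense
    intro r hr
    have hlt : limsup (fun N => (μ N : Measure ℝ) K) atTop < ENNReal.ofReal r :=
      h.trans_lt ((ENNReal.lt_ofReal_iff_toReal_lt (measure_ne_top _ _)).2 hr)
    apply limsup_le_of_le (hb0 K)
    filter_upwards [eventually_lt_of_limsup_lt hlt] with N hN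
    exact ((ENNReal.lt_ofReal_iff_toReal_lt (measure_ne_top _ _)).1 hN).le
  have hopen : ∀ K : Set ℝ, IsOpen K →
      (ν : Measure ℝ).real K ≤ limsup (fun N => (μ N : Measure ℝ).real K) atTop := by
    intro K hK
    have h := ProbabilityMeasure.le_liminf_measure_open_of_tendsto hw hK
    apply le_of_forall_lt_imp_le_of_dense
    intro r hr
    rcases lt_or_ge r 0 with hr0 | hr0
    · exact le_limsup_of_frequently_le
        (Eventually.frequently (Eventually.of_forall fun N => hr0.le.trans measureReal_nonneg)) (hb1 K)
    have hlt : ENNReal.ofReal r < liminf (fun N => (μ N : Measure ℝ) K) atTop := by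
      refine lt_of_lt_of_le ?_ h
      exact (ENNReal.ofReal_lt_iff_lt_toReal hr0 (measure_ne_top _ _)).2 hr
    apply le_limsup_of_frequently_le _ (hb1 K)
    apply Eventually.frequently
    filter_upwards [eventually_lt_of_lt_liminf hlt] with N hN
    exact ((ENNReal.ofReal_lt_iff_lt_toReal hr0 (measure_ne_top _ _)).1 hN).le
  have hthick : ∀ ε : ℝ, A + Ioo (-ε) ε = Metric.thickening ε A := by
    intro ε
    rw [← add_ball_zero, Real.ball_eq_Ioo]
    simp
  have hset : ∀ ε : ℝ, upperDensity2 {p | (fun n m : ℕ => Int.fract (n * α + β) *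
      Int.fract (m * γ + δ)) p.1 p.2 ∉ A + Set.Ioo (-ε) ε} =
      limsup (fun N => (μ N : Measure ℝ).real (Metric.thickening ε A)ᶜ) atTop := by
    intro ε
    rw [hthick, ← hden _ Metric.isOpen_thickening.measurableSet.compl]
    rfl
  rw [idxSet2]
  simp_rw [hset]
  set D : ℝ → ℝ := fun ε => limsup (fun N => (μ N : Measure ℝ).real (Metric.thickening ε A)ᶜ) atTop
    with hD
  have hle : ∀ ε > 0, D ε ≤ 1 - (ν : Measure ℝ).real (closure A) := by
    intro ε hε
    refine (hclosed _ Metric.isOpen_thickening.isClosed_compl).trans ?_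
    rw [probReal_compl_eq_one_sub Metric.isOpen_thickening.measurableSet]
    have := measureReal_mono (μ := (ν : Measure ℝ)) (Metric.closure_subset_thickening hε A)
    linarith
  have h0 : 0 ≤ 1 - (ν : Measure ℝ).real (closure A) := by
    linarith [measureReal_le_one (μ := (ν : Measure ℝ)) (s := closure A)]
  have hge : ∀ ε > 0, 1 - (ν : Measure ℝ).real (Metric.cthickening ε A) ≤ D ε := by
    intro ε hε
    rw [← probReal_compl_eq_one_sub Metric.isClosed_cthickening.measurableSet]
    refine (hopen _ Metric.isClosed_cthickening.isOpen_compl).trans ?_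
    apply limsup_le_limsup _ (hb0 _) (hb1 _)
    refine Eventually.of_forall fun N => ?_
    exact measureReal_mono (compl_subset_compl.2 (Metric.thickening_subset_cthickening ε A))
  have hle' : ∀ ε : ℝ, (⨆ (_ : ε > 0), D ε) ≤ 1 - (ν : Measure ℝ).real (closure A) :=
    fun ε => Real.iSup_le (fun h => hle ε h) h0
  have hsup : (⨆ ε > (0:ℝ), D ε) = 1 - (ν : Measure ℝ).real (closure A) := by
    apply le_antisymm (Real.iSup_le hle' h0)
    have ht : Tendsto (fun ε : ℝ => 1 - (ν : Measure ℝ).real (Metric.cthickening ε A)) (𝓝[>] 0)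
        (𝓝 (1 - (ν : Measure ℝ).real (closure A))) := by
      apply Tendsto.const_sub
      refine (ENNReal.tendsto_toReal (measure_ne_top _ _)).comp ?_
      exact (tendsto_measure_cthickening ⟨1, one_pos, measure_ne_top _ _⟩).mono_left
        nhdsWithin_le_nhds
    apply le_of_tendsto ht
    filter_upwards [self_mem_nhdsWithin] with ε hε
    have hε' : ε > 0 := hε
    refine (hge ε hε').trans ?_
    refine le_trans (le_of_eq ?_) (le_ciSup (f := fun ε : ℝ => ⨆ (_ : ε > 0), D ε)
      ⟨_, forall_mem_range.2 hle'⟩ ε)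
    simp [hε']
  rw [hsup]
  ring
end
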